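/- Interior pointwise–L² bound for time-harmonic Lamé solutions: let μ > 0, λ ∈ ℝ with λ + 2μ > 0, and ω > 0. There exist r₀ > 0 and C > 0, depending only on λ, μ, ω, such that for every z ∈ ℝ³, every 0 < r ≤ r₀, and every vector field u : ℝ³ → ℂ³ that is infinitely differentiable on an open set containing the closed ball of center z and radius r and satisfies μ Δu + (λ+μ) ∇(∇·u) + ω² u = 0 there, one has |u(z)| ≤ C r^{−3/2} ( ∫_{B_r(z)} |u(y)|² dy )^{1/2}. -/

import Mathlib

noncomputable section

abbrev E3 := EuclideanSpace ℝ (Fin 3)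

/-- Partial derivative `∂ⱼ f` of a scalar-valued function on ℝ³. -/
def pd (j : Fin 3) (f : E3 → ℂ) (x : E3) : ℂ :=
  fderiv ℝ f x (EuclideanSpace.single j 1)

/-- Componentwise Laplacian `Δf = Σⱼ ∂ⱼ∂ⱼ f` of a scalar-valued function. -/
def lap (f : E3 → ℂ) (x : E3) : ℂ := ∑ j, pd j (pd j f) x

/-- Divergence `∇·u = Σⱼ ∂ⱼ uⱼ` of a vector field on ℝ³. -/
def div3 (u : E3 → Fin 3 → ℂ) (x : E3) : ℂ := ∑ j, pd j (fun y => u y j) x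

/-- Complex bilinear dot product on ℂ³ (no conjugation): `a·b = Σᵢ aᵢ bᵢ`. -/
def dotc (a b : Fin 3 → ℂ) : ℂ := ∑ i, a i * b i

/-- Pairing `ζ·x = Σᵢ ζᵢ xᵢ` of `ζ ∈ ℂ³` with `x ∈ ℝ³`. -/
def dotR (ζ : Fin 3 → ℂ) (x : E3) : ℂ := ∑ i, ζ i * (x i : ℂ)

open MeasureTheory

/-- The kernel `(1 - |y|²)₊ᵐ`. -/
def ballPow (m : ℕ) (y : E3) : ℝ := (max 0 (1 - ‖y‖ ^ 2)) ^ m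

/-- The weighted mean `∫ (1 - |y|²)₊ᵐ w(z + t y) dy`. -/
def ballMean (m : ℕ) (w : E3 → ℂ) (z : E3) (t : ℝ) : ℂ :=
  ∫ y, (ballPow m y : ℂ) * w (z + t • y)

lemma hasDerivAt_max_zero_pow (m : ℕ) (hm : 1 ≤ m) (x : ℝ) :
    HasDerivAt (fun x : ℝ => (max 0 x) ^ (m + 1)) ((m + 1) * (max 0 x) ^ m) x := by
  rcases lt_trichotomy x 0 with hx | rfl | hx
  · have h : (fun x : ℝ => (max 0 x) ^ (m + 1)) =ᶠ[nhds x] fun _ => 0 := by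
      filter_upwards [gt_mem_nhds hx] with y hy
      simp [max_eq_left hy.le]
    rw [max_eq_left hx.le, zero_pow (by omega), mul_zero]
    exact (hasDerivAt_const x (0 : ℝ)).congr_of_eventuallyEq h
  · rw [max_self, zero_pow (by omega), mul_zero, hasDerivAt_iff_isLittleO]
    have h : (fun x : ℝ => x ^ (m + 1)) =o[nhds 0] fun x => x := by
      simpa using! Asymptotics.isLittleO_pow_pow (𝕜 := ℝ) (show 1 < m + 1 by omega)
    simp only [max_self, sub_zero, smul_zero, ne_eq, Nat.add_eq_zero_iff, one_ne_zero, and_false,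
      not_false_eq_true, zero_pow]
    refine Asymptotics.IsBigO.trans_isLittleO (Asymptotics.IsBigO.of_bound 1 ?_) h
    refine Filter.Eventually.of_forall fun y => ?_
    rw [one_mul, norm_pow, norm_pow]
    refine pow_le_pow_left₀ (norm_nonneg _) ?_ _
    rw [Real.norm_eq_abs, Real.norm_eq_abs, abs_of_nonneg (le_max_left _ _)]
    exact max_le (abs_nonneg _) (le_abs_self _)
  · have h : (fun x : ℝ => (max 0 x) ^ (m + 1)) =ᶠ[nhds x] fun x => x ^ (m + 1) := by
      filter_upwards [lt_mem_nhds hx] with y hy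
      simp [max_eq_right hy.le]
    rw [max_eq_right hx.le]
    simpa using! (hasDerivAt_pow (m + 1) x).congr_of_eventuallyEq h

lemma continuous_ballPow (m : ℕ) : Continuous (ballPow m) := by
  unfold ballPow; fun_prop

lemma ballPow_nonneg (m : ℕ) (y : E3) : 0 ≤ ballPow m y :=
  pow_nonneg (le_max_left _ _) _

lemma ballPow_le_one (m : ℕ) (y : E3) : ballPow m y ≤ 1 :=
  pow_le_one₀ (le_max_left _ _) (max_le zero_le_one (by nlinarith [sq_nonneg ‖y‖]))

lemma ballPow_eq_zero {m : ℕ} (hm : 1 ≤ m) {y : E3} (hy : 1 ≤ ‖y‖) : ballPow m y = 0 := by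
  rw [ballPow, max_eq_left (by nlinarith), zero_pow (by omega)]

lemma hasCompactSupport_ballPow {m : ℕ} (hm : 1 ≤ m) : HasCompactSupport (ballPow m) := by
  refine HasCompactSupport.intro (isCompact_closedBall (0 : E3) 1) fun y hy => ?_
  refine ballPow_eq_zero hm ?_
  simpa using (not_le.1 (by simpa using hy)).le

lemma integrable_ballPow_mul {m : ℕ} (hm : 1 ≤ m) {g : E3 → ℂ} (hg : Continuous g) :
    Integrable fun y => (ballPow m y : ℂ) * g y := by
  have hc : HasCompactSupport fun y => (ballPow m y : ℂ) :=
    (hasCompactSupport_ballPow hm).comp_left (g := fun x : ℝ => (x : ℂ)) Complex.ofReal_zero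
  refine Continuous.integrable_of_hasCompactSupport ?_ hc.mul_right
  exact (Complex.continuous_ofReal.comp (continuous_ballPow m)).mul hg

lemma hasFDerivAt_ballPow {m : ℕ} (hm : 1 ≤ m) (y : E3) :
    HasFDerivAt (fun y => (ballPow (m + 1) y : ℂ))
      (Complex.ofRealCLM.comp ((-(2 * (m + 1)) * ballPow m y) • innerSL ℝ y)) y := by
  have h1 : HasFDerivAt (fun y : E3 => 1 - ‖y‖ ^ 2) (-(2 • innerSL ℝ y)) y :=
    ((hasStrictFDerivAt_norm_sq y).hasFDerivAt).const_sub 1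
  have h2 := (hasDerivAt_max_zero_pow m hm (1 - ‖y‖ ^ 2)).comp_hasFDerivAt y h1
  have h3 : HasFDerivAt (fun y => (ballPow (m + 1) y : ℂ)) _ y :=
    Complex.ofRealCLM.hasFDerivAt.comp y h2
  refine h3.congr_fderiv ?_
  ext v
  simp [ballPow]
  ring

lemma pd_ballPow {m : ℕ} (hm : 1 ≤ m) (j : Fin 3) (y : E3) :
    pd j (fun y => (ballPow (m + 1) y : ℂ)) y = -(2 * (m + 1)) * ballPow m y * y j := by
  rw [pd, (hasFDerivAt_ballPow hm y).fderiv]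
  simp [EuclideanSpace.inner_single_right]

lemma contDiff_pd {w : E3 → ℂ} (hw : ContDiff ℝ (⊤ : ℕ∞) w) (j : Fin 3) :
    ContDiff ℝ (⊤ : ℕ∞) (pd j w) :=
  (hw.fderiv_right (m := (⊤ : ℕ∞)) (by simp)).clm_apply contDiff_const

lemma contDiff_lap {w : E3 → ℂ} (hw : ContDiff ℝ (⊤ : ℕ∞) w) :
    ContDiff ℝ (⊤ : ℕ∞) (lap w) :=
  ContDiff.sum fun j _ => contDiff_pd (contDiff_pd hw j) j

lemma hasCompactSupport_pd {w : E3 → ℂ} (hc : HasCompactSupport w) (j : Fin 3) :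
    HasCompactSupport (pd j w) :=
  hc.fderiv_apply ℝ _

lemma hasCompactSupport_lap {w : E3 → ℂ} (hc : HasCompactSupport w) :
    HasCompactSupport (lap w) := by
  have h : lap w = pd 0 (pd 0 w) + pd 1 (pd 1 w) + pd 2 (pd 2 w) := by
    ext x; simp [lap, Fin.sum_univ_three]
  rw [h]
  exact ((hasCompactSupport_pd (hasCompactSupport_pd hc 0) 0).add
    (hasCompactSupport_pd (hasCompactSupport_pd hc 1) 1)).add
    (hasCompactSupport_pd (hasCompactSupport_pd hc 2) 2)

lemma fderiv_eq_sum_pd (w : E3 → ℂ) (x y : E3) : fderiv ℝ w x y = ∑ j, (y j : ℂ) * pd j w x := by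
  conv_lhs => rw [← (EuclideanSpace.basisFun (Fin 3) ℝ).sum_repr y]
  simp [pd]

lemma integral_ballPow_mul_coord {m : ℕ} (hm : 1 ≤ m) {g : E3 → ℂ} (hg : ContDiff ℝ (⊤ : ℕ∞) g)
    (z : E3) (t : ℝ) (j : Fin 3) :
    ∫ y, (ballPow m y : ℂ) * ((y j : ℂ) * g (z + t • y)) =
      (t / (2 * (m + 1)) : ℂ) * ballMean (m + 1) (pd j g) z t := by
  have hd : Differentiable ℝ g := hg.differentiable (by simp)
  have hcomp : Differentiable ℝ fun y => g (z + t • y) := by fun_prop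
  have hpd : ∀ y, fderiv ℝ (fun y => g (z + t • y)) y (EuclideanSpace.single j 1)
      = t * pd j g (z + t • y) := by
    intro y
    have h1 : HasFDerivAt (fun y : E3 => z + t • y) (t • ContinuousLinearMap.id ℝ E3) y :=
      ((hasFDerivAt_id y).const_smul t).const_add z
    rw [show fderiv ℝ (fun y => g (z + t • y)) y = _ from
      ((hd _).hasFDerivAt.comp y h1).fderiv]
    simp [pd]
  have hcg : Continuous fun y => g (z + t • y) := hcomp.continuous
  have hcpd : Continuous fun y => pd j g (z + t • y) :=
    (contDiff_pd hg j).continuous.comp (by fun_prop)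
  have key := integral_mul_fderiv_eq_neg_fderiv_mul_of_integrable (μ := volume) (𝕜 := ℂ)
    (f := fun y => (ballPow (m + 1) y : ℂ)) (g := fun y => g (z + t • y))
    (v := EuclideanSpace.single j 1) ?_ ?_ ?_
    (fun y _ => (hasFDerivAt_ballPow hm y).differentiableAt) (fun y _ => hcomp y)
  · simp_rw [hpd] at key
    have e1 : ∀ y : E3, fderiv ℝ (fun y => (ballPow (m + 1) y : ℂ)) y (EuclideanSpace.single j 1)
        * g (z + t • y) = -(2 * (m + 1)) * ((ballPow m y : ℂ) * ((y j : ℂ) * g (z + t • y))) := by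
      intro y
      rw [show fderiv ℝ (fun y => (ballPow (m + 1) y : ℂ)) y (EuclideanSpace.single j 1) = _ from
        pd_ballPow hm j y]
      ring
    have e2 : ∀ y : E3, (ballPow (m + 1) y : ℂ) * (t * pd j g (z + t • y)) =
        t * ((ballPow (m + 1) y : ℂ) * pd j g (z + t • y)) := fun y => by ring
    simp_rw [e1, e2] at key
    rw [integral_const_mul, integral_const_mul] at key
    have hm0 : (2 * (m + 1) : ℂ) ≠ 0 := by
      have : (m + 1 : ℂ) ≠ 0 := by exact_mod_cast Nat.succ_ne_zero m
      simpa using this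
    rw [ballMean, div_mul_eq_mul_div, eq_div_iff hm0, key]
    ring
  · have : (fun y : E3 => fderiv ℝ (fun y => (ballPow (m + 1) y : ℂ)) y (EuclideanSpace.single j 1)
        * g (z + t • y)) = fun y => (ballPow m y : ℂ) * (-(2 * (m + 1)) * y j * g (z + t • y)) := by
      ext y
      rw [show fderiv ℝ (fun y => (ballPow (m + 1) y : ℂ)) y (EuclideanSpace.single j 1) = _ from
        pd_ballPow hm j y]
      ring
    rw [this]
    exact integrable_ballPow_mul hm (by fun_prop)
  · simp_rw [hpd]
    exact integrable_ballPow_mul (by omega) (by fun_prop)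
  · exact integrable_ballPow_mul (by omega) hcg

lemma hasDerivAt_ballMean {m : ℕ} (hm : 1 ≤ m) {w : E3 → ℂ} (hw : ContDiff ℝ (⊤ : ℕ∞) w)
    (hc : HasCompactSupport w) (z : E3) (t : ℝ) :
    HasDerivAt (ballMean m w z) ((t / (2 * (m + 1)) : ℂ) * ballMean (m + 1) (lap w) z t) t := by
  have hd : Differentiable ℝ w := hw.differentiable (by simp)
  have hcf : Continuous (fderiv ℝ w) := hw.continuous_fderiv (by simp)
  obtain ⟨M, hM⟩ := (hc.fderiv ℝ).exists_bound_of_continuous hcf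
  have hcw := hw.continuous
  have main := (hasDerivAt_integral_of_dominated_loc_of_deriv_le (μ := volume) (𝕜 := ℝ)
    (F := fun t (y : E3) => (ballPow m y : ℂ) * w (z + t • y)) (x₀ := t) (s := Set.univ)
    (F' := fun t y => (ballPow m y : ℂ) * fderiv ℝ w (z + t • y) y)
    (bound := fun y => ‖(ballPow m y : ℂ) * ((M * ‖y‖ : ℝ) : ℂ)‖) Filter.univ_mem
    (Filter.Eventually.of_forall fun s =>
      (integrable_ballPow_mul hm (by fun_prop)).aestronglyMeasurable)
    (integrable_ballPow_mul hm (by fun_prop))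
    (integrable_ballPow_mul hm (by fun_prop)).aestronglyMeasurable
    (Filter.Eventually.of_forall fun y s _ => ?_)
    (integrable_ballPow_mul hm (by fun_prop)).norm
    (Filter.Eventually.of_forall fun y s _ => ?_)).2
  · refine HasDerivAt.congr_deriv main ?_
    have e : ∀ y : E3, (ballPow m y : ℂ) * fderiv ℝ w (z + t • y) y
        = ∑ j, (ballPow m y : ℂ) * ((y j : ℂ) * pd j w (z + t • y)) := fun y => by
      rw [fderiv_eq_sum_pd, Finset.mul_sum]
    simp_rw [e]
    have hpc : ∀ j, Continuous (pd j w) := fun j => (contDiff_pd hw j).continuous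
    have hppc : ∀ j, Continuous (pd j (pd j w)) := fun j =>
      (contDiff_pd (contDiff_pd hw j) j).continuous
    rw [integral_finsetSum _ fun j _ => integrable_ballPow_mul hm (by fun_prop)]
    simp_rw [integral_ballPow_mul_coord hm (contDiff_pd hw _) z t]
    rw [← Finset.mul_sum]
    congr 1
    unfold ballMean
    rw [← integral_finsetSum _ fun j _ => integrable_ballPow_mul (by omega) (by fun_prop)]
    simp_rw [lap, Finset.mul_sum]
  · rw [norm_mul, norm_mul]
    gcongr
    rw [Complex.norm_real, Real.norm_eq_abs]
    refine le_trans ?_ (le_abs_self _)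
    exact (ContinuousLinearMap.le_opNorm _ _).trans (by gcongr; exact hM _)
  · have h1 : HasDerivAt (fun s : ℝ => z + s • y) y s := by
      simpa using! ((hasDerivAt_id s).smul_const y).const_add z
    exact ((hd _).hasFDerivAt.comp_hasDerivAt s h1).const_mul _

lemma integral_le_sqrt_mul_sqrt {α : Type*} [MeasurableSpace α] (ν : Measure α)
    [IsFiniteMeasure ν] {f : α → ℝ} (hf : ∀ x, 0 ≤ f x) (hf2 : MemLp f 2 ν) :
    ∫ x, f x ∂ν ≤ √(ν.real Set.univ) * √(∫ x, f x ^ 2 ∂ν) := by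
  have h := integral_mul_le_Lp_mul_Lq_of_nonneg (μ := ν) (p := 2) (q := 2)
    Real.HolderConjugate.two_two (f := fun _ => 1) (g := f)
    (Filter.Eventually.of_forall fun _ => zero_le_one) (Filter.Eventually.of_forall hf)
    (memLp_const 1) (by simpa using hf2)
  simpa [Real.sqrt_eq_rpow] using h

lemma setIntegral_ball_comp_add_smul (h : E3 → ℝ) (z : E3) {t : ℝ} (ht : 0 < t) :
    ∫ y in Metric.ball (0 : E3) 1, h (z + t • y) = (t ^ 3)⁻¹ * ∫ y in Metric.ball z t, h y := by
  rw [← integral_indicator measurableSet_ball, ← integral_indicator measurableSet_ball]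
  have e : ∀ y, (Metric.ball (0 : E3) 1).indicator (fun y => h (z + t • y)) y
      = (fun x => (Metric.ball z t).indicator h (z + x)) (t • y) := by
    intro y
    have : y ∈ Metric.ball (0 : E3) 1 ↔ z + t • y ∈ Metric.ball z t := by
      simp [norm_smul, abs_of_pos ht, ht]
    by_cases hy : y ∈ Metric.ball (0 : E3) 1
    · simp only [Set.indicator_of_mem hy, Set.indicator_of_mem (this.1 hy)]
    · simp only [Set.indicator_of_notMem hy, Set.indicator_of_notMem (fun h => hy (this.2 h))]
  simp_rw [e]
  rw [Measure.integral_comp_smul volume (fun x => (Metric.ball z t).indicator h (z + x)) t,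
    integral_add_left_eq_self]
  simp [abs_of_pos ht]

lemma norm_ballMean_le {m : ℕ} (hm : 1 ≤ m) {w : E3 → ℂ} (hw : Continuous w)
    (hc : HasCompactSupport w) (z : E3) {t r : ℝ} (ht : 0 < t) (htr : t ≤ r) :
    ‖ballMean m w z t‖ ≤ √(volume.real (Metric.ball (0 : E3) 1)) *
      √(∫ y in Metric.ball z r, ‖w y‖ ^ 2) / (t * √t) := by
  obtain ⟨M, hM⟩ := hc.exists_bound_of_continuous hw
  have : IsFiniteMeasure (volume.restrict (Metric.ball (0 : E3) 1)) :=
    ⟨by simp⟩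
  have hint : IntegrableOn (fun y => ‖w y‖ ^ 2) (Metric.ball z r) :=
    ((hw.norm.pow 2).continuousOn.integrableOn_compact (isCompact_closedBall z r)).mono_set
      Metric.ball_subset_closedBall
  have hmem : MemLp (fun y => ‖w (z + t • y)‖) 2 (volume.restrict (Metric.ball (0 : E3) 1)) :=
    MemLp.of_bound (by fun_prop) M (Filter.Eventually.of_forall fun y => by simpa using hM _)
  have h1 : ‖ballMean m w z t‖ ≤ ∫ y in Metric.ball (0 : E3) 1, ‖w (z + t • y)‖ := by
    rw [← integral_indicator measurableSet_ball]
    refine norm_integral_le_of_norm_le ((integrable_indicator_iff measurableSet_ball).2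
      (hmem.integrable (by norm_num))) (Filter.Eventually.of_forall fun y => ?_)
    by_cases hy : y ∈ Metric.ball (0 : E3) 1
    · rw [Set.indicator_of_mem hy, norm_mul, Complex.norm_real, Real.norm_eq_abs,
        abs_of_nonneg (ballPow_nonneg m y)]
      exact mul_le_of_le_one_left (norm_nonneg _) (ballPow_le_one m y)
    · rw [Set.indicator_of_notMem hy, ballPow_eq_zero hm (by simpa using hy)]
      simp
  refine h1.trans ((integral_le_sqrt_mul_sqrt _ (fun y => norm_nonneg _) hmem).trans ?_)
  rw [setIntegral_ball_comp_add_smul (fun y => ‖w y‖ ^ 2) z ht, measureReal_restrict_apply_univ,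
    mul_div_assoc, Real.sqrt_mul (by positivity), Real.sqrt_inv, inv_mul_eq_div]
  have hs : √(t ^ 3) = t * √t := by
    rw [pow_succ, Real.sqrt_mul (by positivity), Real.sqrt_sq ht.le]
  rw [hs]
  gcongr
  exact Filter.Eventually.of_forall fun y => by positivity

lemma norm_sub_le_of_norm_deriv_le_div_sqrt {f f' : ℝ → ℂ} {r M : ℝ} (hM : 0 ≤ M)
    (hf : ∀ t, HasDerivAt f (f' t) t) (hb : ∀ t, 0 < t → t ≤ r → ‖f' t‖ ≤ M / √t) {t : ℝ}
    (ht : 0 ≤ t) (htr : t ≤ r) : ‖f t - f 0‖ ≤ 2 * M * √t := by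
  have hd : ∀ s : ℝ, HasDerivAt (fun s => f (s ^ 2)) ((2 * s) • f' (s ^ 2)) s := by
    intro s
    have h := (hf (s ^ 2)).scomp s (hasDerivAt_pow 2 s)
    simpa using! h
  have hmv := norm_image_sub_le_of_norm_deriv_le_segment' (a := 0) (b := √t) (C := 2 * M)
    (fun s _ => (hd s).hasDerivWithinAt) (fun s hs => ?_) (√t) ⟨Real.sqrt_nonneg _, le_rfl⟩
  · simpa [Real.sq_sqrt ht] using hmv
  · rcases hs.1.eq_or_lt with rfl | h0
    · simpa using hM
    · have hst : s ^ 2 ≤ r := by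
        refine le_trans ?_ htr
        calc s ^ 2 ≤ √t ^ 2 := by gcongr; exact hs.2.le
          _ = t := Real.sq_sqrt ht
      have := hb (s ^ 2) (by positivity) hst
      rw [Real.sqrt_sq h0.le] at this
      rw [norm_smul, Real.norm_eq_abs, abs_of_pos (by positivity)]
      calc 2 * s * ‖f' (s ^ 2)‖ ≤ 2 * s * (M / s) := by gcongr
        _ = 2 * M := by field_simp

lemma ballMean_zero (m : ℕ) (w : E3 → ℂ) (z : E3) :
    ballMean m w z 0 = ((∫ y, ballPow m y : ℝ) : ℂ) * w z := by
  simp [ballMean, integral_mul_const, integral_complex_ofReal]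

lemma integral_ballPow_pos {m : ℕ} (hm : 1 ≤ m) : 0 < ∫ y, ballPow m y := by
  refine (continuous_ballPow m).integral_pos_of_hasCompactSupport_nonneg_nonzero
    (hasCompactSupport_ballPow hm) (ballPow_nonneg m) (x := 0) ?_
  simp [ballPow]

lemma ballMean_congr {m : ℕ} (hm : 1 ≤ m) {f g : E3 → ℂ} {z : E3} {t r : ℝ} (ht : 0 ≤ t)
    (htr : t ≤ r) (h : ∀ x ∈ Metric.closedBall z r, f x = g x) :
    ballMean m f z t = ballMean m g z t := by
  refine integral_congr_ae (Filter.Eventually.of_forall fun y => ?_)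
  rcases le_total 1 ‖y‖ with hy | hy
  · simp [ballPow_eq_zero hm hy]
  · have hmem : z + t • y ∈ Metric.closedBall z r := by
      simp only [Metric.mem_closedBall, dist_self_add_left, norm_smul, Real.norm_eq_abs,
        abs_of_nonneg ht]
      nlinarith [norm_nonneg y]
    simp only [h _ hmem]

lemma norm_le_of_lap_lap_eq (p q : ℝ) {w : E3 → ℂ} (hw : ContDiff ℝ (⊤ : ℕ∞) w)
    (hc : HasCompactSupport w) {z : E3} {r : ℝ} (hr : 0 < r) (hr1 : r ≤ 1)
    (h : ∀ x ∈ Metric.closedBall z r, lap (lap w) x = -p * lap w x - q * w x) :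
    ‖w z‖ ≤ √(volume.real (Metric.ball (0 : E3) 1)) * (10 * (|p| + |q|) + 17) /
      (3 * ∫ y, ballPow 1 y) * √(∫ y in Metric.ball z r, ‖w y‖ ^ 2) / (r * √r) := by
  set K := √(volume.real (Metric.ball (0 : E3) 1)) * √(∫ y in Metric.ball z r, ‖w y‖ ^ 2) with hK
  have hK0 : 0 ≤ K := by positivity
  have hA : ∀ m, 1 ≤ m → ∀ t, 0 < t → t ≤ r → ‖ballMean m w z t‖ ≤ K / (t * √t) :=
    fun m hm t ht htr => norm_ballMean_le hm hw.continuous hc z ht htr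
  have hlw := contDiff_lap hw
  have hlc := hasCompactSupport_lap hc
  have hB3 : ∀ t, 0 ≤ t → t ≤ r → ballMean 3 (lap (lap w)) z t =
      -p * ballMean 3 (lap w) z t - q * ballMean 3 w z t := by
    intro t ht htr
    rw [ballMean_congr (by norm_num) ht htr h]
    unfold ballMean
    have hcw := hw.continuous
    have hclw := hlw.continuous
    rw [← integral_const_mul, ← integral_const_mul, ← integral_sub]
    · congr 1 with y
      ring
    · exact (integrable_ballPow_mul (by norm_num) (by fun_prop)).const_mul _
    · exact (integrable_ballPow_mul (by norm_num) (by fun_prop)).const_mul _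
  set f : ℝ → ℂ := fun t => ballMean 2 (lap w) z t + p * ballMean 2 w z t with hf
  have hfd : ∀ t : ℝ, HasDerivAt f ((t / 6 : ℂ) * ballMean 3 (lap (lap w)) z t +
      p * ((t / 6 : ℂ) * ballMean 3 (lap w) z t)) t := by
    intro t
    have h1 := hasDerivAt_ballMean (m := 2) (by norm_num) hlw hlc z t
    have h2 := hasDerivAt_ballMean (m := 2) (by norm_num) hw hc z t
    norm_num at h1 h2
    exact h1.add (h2.const_mul _)
  have hfb : ∀ t, 0 ≤ t → t ≤ r → ‖f t - f 0‖ ≤ 2 * (|q| * K / 6) * √t := by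
    intro t ht htr
    refine norm_sub_le_of_norm_deriv_le_div_sqrt (by positivity) hfd (fun t ht htr => ?_) ht htr
    rw [hB3 t ht.le htr, show (t / 6 : ℂ) * (-p * ballMean 3 (lap w) z t - q * ballMean 3 w z t) +
      p * ((t / 6 : ℂ) * ballMean 3 (lap w) z t) = -(((t / 6 * q : ℝ) : ℂ) * ballMean 3 w z t) by
        push_cast; ring, norm_neg, norm_mul, Complex.norm_real, Real.norm_eq_abs, abs_mul,
      abs_of_pos (by positivity : 0 < t / 6)]
    calc t / 6 * |q| * ‖ballMean 3 w z t‖ ≤ t / 6 * |q| * (K / (t * √t)) := by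
          gcongr; exact hA 3 (by norm_num) t ht htr
      _ = |q| * K / 6 / √t := by
          have := Real.sqrt_pos.2 ht
          field_simp
  set g : ℝ → ℂ := fun t => ballMean 1 w z t - (t : ℂ) ^ 2 / 8 * f 0 with hg
  have hgd : ∀ t : ℝ, HasDerivAt g ((t / 4 : ℂ) * ballMean 2 (lap w) z t - t / 4 * f 0) t := by
    intro t
    have h1 := hasDerivAt_ballMean (m := 1) (by norm_num) hw hc z t
    norm_num at h1
    have h2 : HasDerivAt (fun t : ℝ => (t : ℂ) ^ 2 / 8 * f 0) (t / 4 * f 0) t := by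
      have h3 : HasDerivAt (fun t : ℝ => (t : ℂ)) 1 t := Complex.ofRealCLM.hasDerivAt
      refine (((h3.pow 2).div_const 8).mul_const (f 0)).congr_deriv ?_
      push_cast
      ring
    exact h1.sub h2
  have hgb : ∀ t, 0 ≤ t → t ≤ r → ‖g t - g 0‖ ≤ 2 * ((|p| + |q|) * K) * √t := by
    intro t ht htr
    refine norm_sub_le_of_norm_deriv_le_div_sqrt (by positivity) hgd (fun t ht htr => ?_) ht htr
    have hst := Real.sqrt_pos.2 ht
    have ht1 : t ≤ 1 := htr.trans hr1
    have htt : √t * √t = t := Real.mul_self_sqrt ht.le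
    rw [show (t / 4 : ℂ) * ballMean 2 (lap w) z t - t / 4 * f 0 =
      ((t / 4 : ℝ) : ℂ) * ((f t - f 0) - p * ballMean 2 w z t) by
        simp only [hf]; push_cast; ring, norm_mul, Complex.norm_real, Real.norm_eq_abs,
      abs_of_pos (by positivity : 0 < t / 4)]
    calc t / 4 * ‖(f t - f 0) - p * ballMean 2 w z t‖
        ≤ t / 4 * (2 * (|q| * K / 6) * √t + |p| * (K / (t * √t))) := by
          gcongr
          refine (norm_sub_le _ _).trans (add_le_add (hfb t ht.le htr) ?_)
          rw [norm_mul, Complex.norm_real, Real.norm_eq_abs]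
          gcongr
          exact hA 2 (by norm_num) t ht htr
      _ = (|q| * K * (t * t) / 12 + |p| * K / 4) / √t := by
          rw [eq_div_iff hst.ne']
          field_simp
          rw [Real.sq_sqrt ht.le]
          ring
      _ ≤ ((|p| + |q|) * K) / √t := by
          gcongr
          have h1 : |q| * K * (t * t) ≤ |q| * K :=
            mul_le_of_le_one_right (by positivity) (by nlinarith)
          have h2 : 0 ≤ |q| * K := by positivity
          have h3 : 0 ≤ |p| * K := by positivity
          linarith
  have hsr := Real.sqrt_pos.2 hr
  have hsr1 : √r ≤ 1 := Real.sqrt_le_one.2 hr1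
  set c := ∫ y, ballPow 1 y with hcdef
  have hcpos : 0 < c := integral_ballPow_pos le_rfl
  have hg0 : g 0 = c * w z := by
    simp [hg, ballMean_zero, hcdef]
  have hid : ((3 * c : ℝ) : ℂ) * w z = (4 * (ballMean 1 w z (r / 2)) - ballMean 1 w z r) +
      ((g r - g 0) - 4 * (g (r / 2) - g 0)) := by
    have h3 : ((3 * c : ℝ) : ℂ) * w z = 3 * g 0 := by rw [hg0]; push_cast; ring
    rw [h3]
    simp only [hg]
    push_cast
    ring
  have hhalf : K / (r / 2 * √(r / 2)) ≤ 4 * (K / (r * √r)) := by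
    have h1 : √r / 2 ≤ √(r / 2) := by
      refine Real.le_sqrt_of_sq_le ?_
      rw [div_pow, Real.sq_sqrt hr.le]
      linarith
    calc K / (r / 2 * √(r / 2)) ≤ K / (r / 2 * (√r / 2)) := by gcongr
      _ = 4 * (K / (r * √r)) := by field_simp; norm_num
  have hKr : K * √r ≤ K / (r * √r) := by
    rw [le_div_iff₀ (by positivity)]
    have : √r * (r * √r) ≤ 1 := by
      have : r * (√r * √r) ≤ 1 := by rw [Real.mul_self_sqrt hr.le]; nlinarith
      linarith
    calc K * √r * (r * √r) = K * (√r * (r * √r)) := by ring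
      _ ≤ K := mul_le_of_le_one_right hK0 this
  have hfin : 3 * c * ‖w z‖ ≤ (10 * (|p| + |q|) + 17) * (K / (r * √r)) := by
    have e1 : ‖((3 * c : ℝ) : ℂ) * w z‖ = 3 * c * ‖w z‖ := by
      rw [norm_mul, Complex.norm_real, Real.norm_eq_abs, abs_of_pos (by positivity)]
    rw [← e1, hid]
    have n4 : ∀ x : ℂ, ‖4 * x‖ = 4 * ‖x‖ := fun x => by simp
    have b1 := hA 1 le_rfl (r / 2) (by positivity) (by linarith)
    have b2 := hA 1 le_rfl r hr le_rfl
    have b3 := hgb r hr.le le_rfl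
    have b4 := hgb (r / 2) (by positivity) (by linarith)
    have b5 : √(r / 2) ≤ √r := Real.sqrt_le_sqrt (by linarith)
    have b6 : 2 * ((|p| + |q|) * K) * √(r / 2) ≤ 2 * ((|p| + |q|) * K) * √r := by gcongr
    have b7 : (|p| + |q|) * (K * √r) ≤ (|p| + |q|) * (K / (r * √r)) := by gcongr
    calc _ ≤ ‖4 * (ballMean 1 w z (r / 2)) - ballMean 1 w z r‖ +
          ‖(g r - g 0) - 4 * (g (r / 2) - g 0)‖ := norm_add_le _ _
      _ ≤ (4 * ‖ballMean 1 w z (r / 2)‖ + ‖ballMean 1 w z r‖) +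
          (‖g r - g 0‖ + 4 * ‖g (r / 2) - g 0‖) := by
          rw [← n4, ← n4]
          gcongr <;> exact norm_sub_le _ _
      _ ≤ _ := by linarith
  calc ‖w z‖ = (3 * c * ‖w z‖) / (3 * c) := by field_simp
    _ ≤ ((10 * (|p| + |q|) + 17) * (K / (r * √r))) / (3 * c) := by gcongr
    _ = _ := by rw [hK]; field_simp

lemma pd_congr {f g : E3 → ℂ} {V : Set E3} (hV : IsOpen V) (h : Set.EqOn f g V) (j : Fin 3) :
    Set.EqOn (pd j f) (pd j g) V := fun x hx => by
  rw [pd, pd, (h.eventuallyEq_of_mem (hV.mem_nhds hx)).fderiv_eq]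

lemma lap_congr {f g : E3 → ℂ} {V : Set E3} (hV : IsOpen V) (h : Set.EqOn f g V) :
    Set.EqOn (lap f) (lap g) V := fun _ hx =>
  Finset.sum_congr rfl fun j _ => pd_congr hV (pd_congr hV h j) j hx

lemma pd_zero (j : Fin 3) : pd j (fun _ => 0) = fun _ => 0 := by
  ext x; simp [pd]

lemma lap_zero : lap (fun _ => 0) = fun _ => 0 := by
  ext x; simp [lap, pd_zero]

lemma pd_comm {f : E3 → ℂ} (hf : ContDiff ℝ (⊤ : ℕ∞) f) (i j : Fin 3) :
    pd i (pd j f) = pd j (pd i f) := by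
  ext x
  have hd : DifferentiableAt ℝ (fderiv ℝ f) x :=
    ((hf.fderiv_right (m := (⊤ : ℕ∞)) (by simp)).differentiable (by simp)) x
  have hpd : ∀ k l, pd l (pd k f) x =
      fderiv ℝ (fderiv ℝ f) x (EuclideanSpace.single l 1) (EuclideanSpace.single k 1) := by
    intro k l
    change fderiv ℝ (fun y => fderiv ℝ f y (EuclideanSpace.single k 1)) x _ = _
    rw [fderiv_clm_apply hd (differentiableAt_const _)]
    simp
  rw [hpd, hpd]
  exact (hf.contDiffAt.isSymmSndFDerivAt (by
    simpa using WithTop.coe_le_coe.2 (le_top : (2 : ℕ∞) ≤ ⊤))).eq _ _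

lemma pd_sum {f : Fin 3 → E3 → ℂ} (hf : ∀ k, ContDiff ℝ (⊤ : ℕ∞) (f k)) (j : Fin 3) :
    pd j (fun x => ∑ k, f k x) = fun x => ∑ k, pd j (f k) x := by
  ext x
  simp only [pd]
  rw [fderiv_fun_sum fun k _ => (hf k).differentiable (by simp) x]
  simp

lemma lap_sum {f : Fin 3 → E3 → ℂ} (hf : ∀ k, ContDiff ℝ (⊤ : ℕ∞) (f k)) :
    lap (fun x => ∑ k, f k x) = fun x => ∑ k, lap (f k) x := by
  ext x
  simp only [lap]
  rw [Finset.sum_comm]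
  refine Finset.sum_congr rfl fun j _ => ?_
  rw [pd_sum hf, pd_sum fun k => contDiff_pd (hf k) j]

lemma pd_lap {f : E3 → ℂ} (hf : ContDiff ℝ (⊤ : ℕ∞) f) (j : Fin 3) :
    pd j (lap f) = lap (pd j f) := by
  ext x
  rw [show lap f = fun x => ∑ k, pd k (pd k f) x from rfl,
    pd_sum fun k => contDiff_pd (contDiff_pd hf k) k]
  refine Finset.sum_congr rfl fun k _ => ?_
  rw [pd_comm (contDiff_pd hf k) j k, pd_comm hf j k]

lemma pd_linear_combination {f g h : E3 → ℂ} (hf : ContDiff ℝ (⊤ : ℕ∞) f)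
    (hg : ContDiff ℝ (⊤ : ℕ∞) g) (hh : ContDiff ℝ (⊤ : ℕ∞) h) (a b c : ℂ) (j : Fin 3) :
    pd j (fun x => a * f x + b * g x + c * h x) =
      fun x => a * pd j f x + b * pd j g x + c * pd j h x := by
  ext x
  have df := (hf.differentiable (by simp) x).hasFDerivAt.const_mul a
  have dg := (hg.differentiable (by simp) x).hasFDerivAt.const_mul b
  have dh := (hh.differentiable (by simp) x).hasFDerivAt.const_mul c
  rw [pd, show fderiv ℝ (fun x => a * f x + b * g x + c * h x) x = _ from
    ((df.add dg).add dh).fderiv]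
  simp [pd]

lemma lap_linear_combination {f g h : E3 → ℂ} (hf : ContDiff ℝ (⊤ : ℕ∞) f)
    (hg : ContDiff ℝ (⊤ : ℕ∞) g) (hh : ContDiff ℝ (⊤ : ℕ∞) h) (a b c : ℂ) :
    lap (fun x => a * f x + b * g x + c * h x) =
      fun x => a * lap f x + b * lap g x + c * lap h x := by
  ext x
  simp only [lap, Finset.mul_sum, ← Finset.sum_add_distrib]
  refine Finset.sum_congr rfl fun j _ => ?_
  rw [pd_linear_combination hf hg hh,
    pd_linear_combination (contDiff_pd hf j) (contDiff_pd hg j) (contDiff_pd hh j)]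

/-- Each component of a time-harmonic Lamé field is annihilated by the product of the Helmholtz
operators of the shear and pressure waves. -/
lemma lap_lap_eq_of_lame {μ lam ω : ℝ} (hμ : 0 < μ) (hlm : 0 < lam + 2 * μ) {w : Fin 3 → E3 → ℂ}
    (hw : ∀ i, ContDiff ℝ (⊤ : ℕ∞) (w i)) {V : Set E3} (hV : IsOpen V)
    (h : ∀ x ∈ V, ∀ i, (μ : ℂ) * lap (w i) x
      + ((lam : ℂ) + (μ : ℂ)) * pd i (fun y => ∑ j, pd j (w j) y) x + (ω : ℂ) ^ 2 * w i x = 0)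
    {x : E3} (hx : x ∈ V) (i : Fin 3) :
    lap (lap (w i)) x =
      -((ω ^ 2 * (lam + 3 * μ) / (μ * (lam + 2 * μ)) : ℝ) : ℂ) * lap (w i) x
        - ((ω ^ 4 / (μ * (lam + 2 * μ)) : ℝ) : ℂ) * w i x := by
  set d : E3 → ℂ := fun y => ∑ j, pd j (w j) y with hd
  have hdc : ContDiff ℝ (⊤ : ℕ∞) d := ContDiff.sum fun j _ => contDiff_pd (hw j) j
  have hpdd := fun i => contDiff_pd hdc i
  have hl := fun i => contDiff_lap (hw i)
  have e0 : ∀ i, Set.EqOn (fun x => (μ : ℂ) * lap (w i) x + ((lam : ℂ) + (μ : ℂ)) * pd i d x +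
      (ω : ℂ) ^ 2 * w i x) (fun _ => 0) V := fun i x hx => h x hx i
  have hdiv : Set.EqOn (fun x => ((lam : ℂ) + 2 * μ) * lap d x + (ω : ℂ) ^ 2 * d x + 0 * d x)
      (fun _ => 0) V := by
    intro x hx
    have e1 : ∀ i, (μ : ℂ) * lap (pd i (w i)) x + ((lam : ℂ) + (μ : ℂ)) * pd i (pd i d) x +
        (ω : ℂ) ^ 2 * pd i (w i) x = 0 := by
      intro i
      have := pd_congr hV (e0 i) i hx
      rw [pd_linear_combination (hl i) (hpdd i) (hw i), pd_zero, pd_lap (hw i)] at this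
      exact this
    have e2 : lap d x = ∑ i, lap (pd i (w i)) x := by
      rw [hd, lap_sum fun j => contDiff_pd (hw j) j]
    have e3 : ∑ i, lap (pd i (w i)) x = ∑ i, pd i (pd i d) x := e2.symm
    have e4 : lap d x = ∑ i, pd i (pd i d) x := rfl
    have e5 := Finset.sum_eq_zero fun i (_ : i ∈ Finset.univ) => e1 i
    rw [Finset.sum_add_distrib, Finset.sum_add_distrib, ← Finset.mul_sum, ← Finset.mul_sum,
      ← Finset.mul_sum, e3, ← e4, show ∑ i, pd i (w i) x = d x from rfl] at e5
    linear_combination e5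
  have e1 := h x hx i
  have e2 := pd_congr hV hdiv i hx
  rw [pd_linear_combination (contDiff_lap hdc) hdc hdc, pd_zero, pd_lap hdc] at e2
  have e3 := lap_congr hV (e0 i) hx
  rw [lap_linear_combination (hl i) (hpdd i) (hw i), lap_zero] at e3
  have hμ' : (μ : ℂ) ≠ 0 := by exact_mod_cast hμ.ne'
  have hlm' : (lam + 2 * μ : ℂ) ≠ 0 := by exact_mod_cast hlm.ne'
  have hne : (μ * (lam + 2 * μ) : ℂ) ≠ 0 := mul_ne_zero hμ' hlm'
  have hp := div_mul_cancel₀ (ω ^ 2 * (lam + 3 * μ) : ℂ) hne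
  have hq := div_mul_cancel₀ (ω ^ 4 : ℂ) hne
  push_cast
  refine mul_left_cancel₀ hne ?_
  linear_combination lap (w i) x * hp + w i x * hq + (lam + 2 * μ : ℂ) * e3 - (lam + μ : ℂ) * e2 + (ω : ℂ) ^ 2 * e1

lemma exists_contDiff_hasCompactSupport_eqOn_ball {f : E3 → ℂ} {U : Set E3} (hU : IsOpen U)
    (hf : ContDiffOn ℝ (⊤ : ℕ∞) f U) {z : E3} {r δ : ℝ} (hr : 0 < r) (hδ : 0 < δ)
    (hsub : Metric.ball z (r + δ) ⊆ U) :
    ∃ g : E3 → ℂ, ContDiff ℝ (⊤ : ℕ∞) g ∧ HasCompactSupport g ∧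
      Set.EqOn f g (Metric.ball z (r + δ / 3)) := by
  let b : ContDiffBump z := ⟨r + δ / 3, r + δ / 2, by positivity, by linarith⟩
  refine ⟨fun x => b x • f x, contDiff_iff_contDiffAt.2 fun x => ?_,
    b.hasCompactSupport.smul_right, fun x hx => ?_⟩
  · by_cases hx : x ∈ Metric.ball z (r + δ)
    · exact b.contDiffAt.smul (hf.contDiffAt (hU.mem_nhds (hsub hx)))
    · have hx' : x ∉ tsupport b := by
        rw [b.tsupport_eq]
        intro hx'
        exact hx (Metric.closedBall_subset_ball (by change r + δ / 2 < r + δ; linarith) hx')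
      have h0 : (fun x => b x • f x) =ᶠ[nhds x] fun _ => 0 := by
        filter_upwards [notMem_tsupport_iff_eventuallyEq.1 hx'] with y hy
        simp [hy]
      exact contDiffAt_const.congr_of_eventuallyEq h0
  · simp only
    rw [b.one_of_mem_closedBall (Metric.ball_subset_closedBall hx), one_smul]

/-- Interior pointwise–L² bound for time-harmonic Lamé solutions: for `μ > 0`,
`λ + 2μ > 0`, `ω > 0`, there exist `r₀ > 0` and `C > 0`, depending only on `λ, μ, ω`,
such that every smooth solution of `μΔu + (λ+μ)∇(∇·u) + ω²u = 0` on a neighborhood of the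
closed ball `B̄_r(z)` with `0 < r ≤ r₀` satisfies
`|u(z)| ≤ C r^{−3/2} (∫_{B_r(z)} |u|²)^{1/2}`. -/
theorem lame_interior_pointwise_L2_bound (μ lam ω : ℝ)
    (hμ : 0 < μ) (hlm : 0 < lam + 2*μ) (hω : 0 < ω) :
    ∃ r₀ : ℝ, 0 < r₀ ∧ ∃ C : ℝ, 0 < C ∧
      ∀ (z : E3) (r : ℝ), 0 < r → r ≤ r₀ →
        ∀ (u : E3 → EuclideanSpace ℂ (Fin 3)) (U : Set E3),
          IsOpen U → Metric.closedBall z r ⊆ U →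
          ContDiffOn ℝ (⊤ : ℕ∞) u U →
          (∀ x ∈ U, ∀ i : Fin 3,
            (μ : ℂ) * lap (fun y => u y i) x
              + ((lam : ℂ) + (μ : ℂ))
                  * pd i (fun y => ∑ j, pd j (fun y' => u y' j) y) x
              + (ω : ℂ)^2 * u x i = 0) →
          ‖u z‖ ≤ C * r ^ (-(3:ℝ)/2) * (∫ y in Metric.ball z r, ‖u y‖^2) ^ ((1:ℝ)/2) := by
  set p : ℝ := ω ^ 2 * (lam + 3 * μ) / (μ * (lam + 2 * μ))
  set q : ℝ := ω ^ 4 / (μ * (lam + 2 * μ))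
  set C₀ : ℝ := √(volume.real (Metric.ball (0 : E3) 1)) * (10 * (|p| + |q|) + 17) /
    (3 * ∫ y, ballPow 1 y) with hC₀
  have hvol : 0 < volume.real (Metric.ball (0 : E3) 1) :=
    ENNReal.toReal_pos (Metric.measure_ball_pos _ _ one_pos).ne' measure_ball_lt_top.ne
  have hC₀pos : 0 < C₀ := by
    have := integral_ballPow_pos (m := 1) le_rfl
    have := Real.sqrt_pos.2 hvol
    positivity
  refine ⟨1, one_pos, 3 * C₀, by positivity, fun z r hr hr1 u U hU hsub hu hpde => ?_⟩
  obtain ⟨δ, hδ, hδU⟩ := (isCompact_closedBall z r).exists_thickening_subset_open hU hsub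
  rw [thickening_closedBall hδ hr.le, add_comm] at hδU
  have hui : ∀ i, ContDiffOn ℝ (⊤ : ℕ∞) (fun y => u y i) U := fun i =>

    ((EuclideanSpace.proj i : EuclideanSpace ℂ (Fin 3) →L[ℂ] ℂ).restrictScalars ℝ).contDiff.comp_contDiffOn
      hu
  choose w hw hwc hwu using fun i =>
    exists_contDiff_hasCompactSupport_eqOn_ball hU (hui i) hr hδ hδU
  set V := Metric.ball z (r + δ / 3) with hVdef
  have hV : IsOpen V := Metric.isOpen_ball
  have hVU : V ⊆ U := (Metric.ball_subset_ball (by linarith)).trans hδU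
  have hBV : Metric.closedBall z r ⊆ V := Metric.closedBall_subset_ball (by linarith)
  have hpde' : ∀ x ∈ V, ∀ i, (μ : ℂ) * lap (w i) x
      + ((lam : ℂ) + (μ : ℂ)) * pd i (fun y => ∑ j, pd j (w j) y) x
      + (ω : ℂ) ^ 2 * w i x = 0 := by
    intro x hx i
    have hdiv : Set.EqOn (fun y => ∑ j, pd j (fun y' => u y' j) y)
        (fun y => ∑ j, pd j (w j) y) V := fun y hy =>
      Finset.sum_congr rfl fun j _ => pd_congr hV (hwu j) j hy
    have e := hpde x (hVU hx) i
    rw [lap_congr hV (hwu i) hx, pd_congr hV hdiv i hx, show u x i = w i x from hwu i hx] at e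
    exact e
  have hint : IntegrableOn (fun y => ‖u y‖ ^ 2) (Metric.ball z r) :=
    (((hu.continuousOn.mono hsub).norm.pow 2).integrableOn_compact
      (isCompact_closedBall z r)).mono_set Metric.ball_subset_closedBall
  have hcomp : ∀ i, ‖u z i‖ ≤ C₀ * √(∫ y in Metric.ball z r, ‖u y‖ ^ 2) / (r * √r) := by
    intro i
    have hb := norm_le_of_lap_lap_eq p q (hw i) (hwc i) hr hr1
      fun x hx => lap_lap_eq_of_lame hμ hlm hw hV hpde' (hBV hx) i
    rw [show u z i = w i z from hwu i (hBV (Metric.mem_closedBall_self hr.le))]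
    refine hb.trans ?_
    gcongr ?_ * √?_ / _
    refine setIntegral_mono_on ?_ hint measurableSet_ball fun y hy => ?_
    · exact (((hw i).continuous.norm.pow 2).continuousOn.integrableOn_compact
        (isCompact_closedBall z r)).mono_set Metric.ball_subset_closedBall
    · rw [← show u y i = w i y from hwu i (hBV (Metric.ball_subset_closedBall hy))]
      gcongr
      exact PiLp.norm_apply_le _ _
  have hrp : r ^ (-(3 : ℝ) / 2) = (r * √r)⁻¹ := by
    rw [show (-(3 : ℝ) / 2) = -(1 + 1 / 2) by norm_num, Real.rpow_neg hr.le, Real.rpow_add hr,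
      Real.rpow_one, ← Real.sqrt_eq_rpow]
  rw [← Real.sqrt_eq_rpow, hrp]
  have hsum : ‖u z‖ ≤ ∑ i, ‖u z i‖ := by
    rw [EuclideanSpace.norm_eq]
    refine Real.sqrt_le_iff.2 ⟨by positivity, ?_⟩
    exact Finset.sum_sq_le_sq_sum_of_nonneg fun i _ => norm_nonneg _
  calc ‖u z‖ ≤ ∑ i, ‖u z i‖ := hsum
    _ ≤ ∑ _i : Fin 3, C₀ * √(∫ y in Metric.ball z r, ‖u y‖ ^ 2) / (r * √r) :=
      Finset.sum_le_sum fun i _ => hcomp i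
    _ = _ := by
      rw [Finset.sum_const, Finset.card_univ, Fintype.card_fin, nsmul_eq_mul]
      push_cast
      ring
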